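/- For n ≥ 8 and f ∈ C_0^∞(ℝⁿ \ {0}): ∫_{ℝⁿ} |Δf(x)|² dⁿx ≥ (n²/4) ∫_{ℝⁿ} |x|^{-2} |∇f(x)|² dⁿx. -/

import Mathlib

open MeasureTheory

noncomputable def lap {n : ℕ} (f : EuclideanSpace ℝ (Fin n) → ℝ)
    (x : EuclideanSpace ℝ (Fin n)) : ℝ :=
  ∑ i : Fin n, fderiv ℝ (fderiv ℝ f) x (EuclideanSpace.single i 1) (EuclideanSpace.single i 1)

namespace RellichHardy

open scoped Topology

/-- The `i`-th partial derivative. -/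
noncomputable def partialDeriv {n : ℕ} (f : EuclideanSpace ℝ (Fin n) → ℝ) (i : Fin n)
    (x : EuclideanSpace ℝ (Fin n)) : ℝ :=
  fderiv ℝ f x (EuclideanSpace.single i 1)

/-- The radial derivative `x · ∇f`. -/
noncomputable def euler {n : ℕ} (f : EuclideanSpace ℝ (Fin n) → ℝ)
    (x : EuclideanSpace ℝ (Fin n)) : ℝ :=
  ∑ j, x j * partialDeriv f j x

/-- The squared length of the gradient, in coordinates. -/
noncomputable def gradSq {n : ℕ} (f : EuclideanSpace ℝ (Fin n) → ℝ)
    (x : EuclideanSpace ℝ (Fin n)) : ℝ :=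
  ∑ j, partialDeriv f j x ^ 2

/-- The `i`-th component of the Pohozaev field `|x|⁻² (2 (x · ∇f) ∇f - |∇f|² x)`. -/
noncomputable def pohozaev {n : ℕ} (f : EuclideanSpace ℝ (Fin n) → ℝ) (i : Fin n)
    (x : EuclideanSpace ℝ (Fin n)) : ℝ :=
  (‖x‖ ^ 2)⁻¹ * (2 * euler f x * partialDeriv f i x - x i * gradSq f x)

theorem integral_fderiv_eq_zero {E : Type*} [NormedAddCommGroup E] [NormedSpace ℝ E]
    [FiniteDimensional ℝ E] [MeasurableSpace E] [BorelSpace E] (μ : Measure E)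
    [μ.IsAddHaarMeasure] {u : E → ℝ} (hu : ContDiff ℝ 1 u) (hc : HasCompactSupport u) (v : E) :
    ∫ x, fderiv ℝ u x v ∂μ = 0 := by
  have hi : Integrable (fun x ↦ fderiv ℝ u x v) μ :=
    ((hu.continuous_fderiv one_ne_zero).clm_apply continuous_const).integrable_of_hasCompactSupport
      (hc.fderiv_apply (𝕜 := ℝ) v)
  have h := integral_mul_fderiv_eq_neg_fderiv_mul_of_integrable (μ := μ) (f := fun _ : E ↦ (1 : ℝ))
    (g := u) (v := v) (by simp) (by simpa using hi)
    (by simpa using hu.continuous.integrable_of_hasCompactSupport hc)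
    (fun x _ ↦ differentiableAt_const _) (fun x _ ↦ (hu.differentiable one_ne_zero) x)
  simpa using h

theorem contDiff_of_eq_zero_off_tsupport {E : Type*} [NormedAddCommGroup E] [NormedSpace ℝ E]
    {f u : E → ℝ} {k : WithTop ℕ∞} (h0 : ∀ x ∈ tsupport f, x ≠ 0)
    (hz : ∀ x, x ∉ tsupport f → u x = 0) (hu : ∀ x, x ≠ 0 → ContDiffAt ℝ k u x) :
    ContDiff ℝ k u := by
  refine contDiff_iff_contDiffAt.2 fun x ↦ ?_
  by_cases hx : x ∈ tsupport f
  · exact hu x (h0 x hx)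
  · refine contDiffAt_const (c := (0 : ℝ)) |>.congr_of_eventuallyEq ?_
    filter_upwards [(isClosed_tsupport f).isOpen_compl.mem_nhds hx] with y hy using hz y hy

variable {n : ℕ} {f : EuclideanSpace ℝ (Fin n) → ℝ}

theorem partialDeriv_eq_zero {x : EuclideanSpace ℝ (Fin n)} (hx : x ∉ tsupport f) (i : Fin n) :
    partialDeriv f i x = 0 := by
  simp [partialDeriv, fderiv_of_notMem_tsupport ℝ hx]

theorem euler_eq_zero {x : EuclideanSpace ℝ (Fin n)} (hx : x ∉ tsupport f) : euler f x = 0 := by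
  simp [euler, partialDeriv_eq_zero hx]

theorem gradSq_eq_zero {x : EuclideanSpace ℝ (Fin n)} (hx : x ∉ tsupport f) : gradSq f x = 0 := by
  simp [gradSq, partialDeriv_eq_zero hx]

theorem pohozaev_eq_zero {x : EuclideanSpace ℝ (Fin n)} (hx : x ∉ tsupport f) (i : Fin n) :
    pohozaev f i x = 0 := by
  simp [pohozaev, euler_eq_zero hx, gradSq_eq_zero hx]

theorem lap_eq_zero {x : EuclideanSpace ℝ (Fin n)} (hx : x ∉ tsupport f) : lap f x = 0 := by
  have h : x ∉ tsupport (fderiv ℝ f) := fun h ↦ hx (tsupport_fderiv_subset ℝ h)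
  simp [lap, fderiv_of_notMem_tsupport ℝ h]

theorem norm_gradient_sq (x : EuclideanSpace ℝ (Fin n)) : ‖gradient f x‖ ^ 2 = gradSq f x := by
  rw [EuclideanSpace.real_norm_sq_eq, gradSq]
  refine Finset.sum_congr rfl fun i _ ↦ ?_
  rw [partialDeriv, ← inner_gradient_left, EuclideanSpace.inner_single_right]
  simp

theorem euler_sq_le (x : EuclideanSpace ℝ (Fin n)) : euler f x ^ 2 ≤ ‖x‖ ^ 2 * gradSq f x := by
  rw [EuclideanSpace.real_norm_sq_eq]
  exact Finset.sum_mul_sq_le_sq_mul_sq _ _ _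

theorem contDiff_partialDeriv (hf : ContDiff ℝ (⊤ : ℕ∞) f) (i : Fin n) :
    ContDiff ℝ 1 (partialDeriv f i) :=
  (hf.fderiv_right (m := 1) (by norm_cast)).clm_apply contDiff_const

theorem contDiff_coord (i : Fin n) : ContDiff ℝ 1 fun x : EuclideanSpace ℝ (Fin n) ↦ x i := by
  fun_prop

theorem contDiff_euler (hf : ContDiff ℝ (⊤ : ℕ∞) f) : ContDiff ℝ 1 (euler f) :=
  ContDiff.sum fun j _ ↦ (contDiff_coord j).mul (contDiff_partialDeriv hf j)

theorem contDiff_gradSq (hf : ContDiff ℝ (⊤ : ℕ∞) f) : ContDiff ℝ 1 (gradSq f) :=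
  ContDiff.sum fun j _ ↦ (contDiff_partialDeriv hf j).pow 2

theorem contDiffAt_inv_norm_sq {x : EuclideanSpace ℝ (Fin n)} (hx : x ≠ 0) :
    ContDiffAt ℝ 1 (fun x : EuclideanSpace ℝ (Fin n) ↦ (‖x‖ ^ 2)⁻¹) x :=
  (contDiff_norm_sq ℝ).contDiffAt.inv (by simpa using hx)

theorem contDiff_pohozaev (hf : ContDiff ℝ (⊤ : ℕ∞) f) (h0 : ∀ x ∈ tsupport f, x ≠ 0)
    (i : Fin n) : ContDiff ℝ 1 (pohozaev f i) :=
  contDiff_of_eq_zero_off_tsupport h0 (fun _ hx ↦ pohozaev_eq_zero hx i) fun _ hx ↦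
    (contDiffAt_inv_norm_sq hx).mul
      (((contDiff_const.mul (contDiff_euler hf)).mul (contDiff_partialDeriv hf i)).sub
        ((contDiff_coord i).mul (contDiff_gradSq hf))).contDiffAt

theorem contDiff_inv_norm_sq_mul_gradSq (hf : ContDiff ℝ (⊤ : ℕ∞) f)
    (h0 : ∀ x ∈ tsupport f, x ≠ 0) : ContDiff ℝ 1 fun x ↦ (‖x‖ ^ 2)⁻¹ * gradSq f x :=
  contDiff_of_eq_zero_off_tsupport h0 (fun _ hx ↦ by simp [gradSq_eq_zero hx]) fun _ hx ↦
    (contDiffAt_inv_norm_sq hx).mul (contDiff_gradSq hf).contDiffAt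

theorem continuous_lap (hf : ContDiff ℝ (⊤ : ℕ∞) f) : Continuous (lap f) := by
  have h1 : ContDiff ℝ 1 (fderiv ℝ f) := hf.fderiv_right (by norm_cast)
  have h2 := h1.continuous_fderiv one_ne_zero
  exact continuous_finsetSum _ fun i _ ↦
    (h2.clm_apply continuous_const).clm_apply continuous_const

theorem fderiv_pohozaev (hf : ContDiff ℝ (⊤ : ℕ∞) f)
    {x : EuclideanSpace ℝ (Fin n)} (hx : x ≠ 0) (i : Fin n) :
    fderiv ℝ (pohozaev f i) x (EuclideanSpace.single i 1) =
      -(2 * x i * ((‖x‖ ^ 2)⁻¹) ^ 2) * (2 * euler f x * partialDeriv f i x - x i * gradSq f x) +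
      (‖x‖ ^ 2)⁻¹ * (2 * (partialDeriv f i x + ∑ j, x j * fderiv ℝ (partialDeriv f j) x
            (EuclideanSpace.single i 1)) * partialDeriv f i x +
          2 * euler f x * fderiv ℝ (partialDeriv f i) x (EuclideanSpace.single i 1) -
        (gradSq f x + x i * ∑ j, 2 * partialDeriv f j x * fderiv ℝ (partialDeriv f j) x
            (EuclideanSpace.single i 1))) := by
  set v : EuclideanSpace ℝ (Fin n) := EuclideanSpace.single i 1 with hv
  have hP : ∀ j, HasFDerivAt (partialDeriv f j) (fderiv ℝ (partialDeriv f j) x) x := fun j ↦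
    ((contDiff_partialDeriv hf j).differentiable one_ne_zero x).hasFDerivAt
  have hX : ∀ j, HasFDerivAt (fun y : EuclideanSpace ℝ (Fin n) ↦ y j)
      (EuclideanSpace.proj j : EuclideanSpace ℝ (Fin n) →L[ℝ] ℝ) x := fun j ↦
    (EuclideanSpace.proj j : EuclideanSpace ℝ (Fin n) →L[ℝ] ℝ).hasFDerivAt
  have hS : HasFDerivAt (euler f) _ x := HasFDerivAt.fun_sum fun j _ ↦ (hX j).mul (hP j)
  have hG : HasFDerivAt (gradSq f) _ x := HasFDerivAt.fun_sum fun j _ ↦ (hP j).pow 2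
  have hN : HasFDerivAt (fun y : EuclideanSpace ℝ (Fin n) ↦ ‖y‖ ^ 2) _ x :=
    (hasStrictFDerivAt_norm_sq x).hasFDerivAt
  have hQ := (hasDerivAt_inv (show ‖x‖ ^ 2 ≠ 0 by simpa using hx)).comp_hasFDerivAt x hN
  have hW : HasFDerivAt (pohozaev f i) _ x :=
    hQ.mul (((hS.const_mul 2).mul (hP i)).sub ((hX i).mul hG))
  have hvj : ∀ j, v j = if j = i then 1 else 0 := fun j ↦ by simp [hv]
  have hin : inner ℝ x v = x i := by simp [hv, EuclideanSpace.inner_single_right]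
  rw [hW.fderiv]
  simp [hvj, hin, Finset.sum_add_distrib]
  ring

theorem fderiv_partialDeriv (hf : ContDiff ℝ (⊤ : ℕ∞) f) (x v : EuclideanSpace ℝ (Fin n))
    (i : Fin n) : fderiv ℝ (partialDeriv f i) x v =
      fderiv ℝ (fderiv ℝ f) x v (EuclideanSpace.single i 1) := by
  have h1 : ContDiff ℝ 1 (fderiv ℝ f) := hf.fderiv_right (by norm_cast)
  have h : HasFDerivAt (partialDeriv f i) _ x :=
    ((h1.differentiable one_ne_zero x).hasFDerivAt).clm_apply
      (hasFDerivAt_const (EuclideanSpace.single i (1 : ℝ)) x)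
  rw [h.fderiv]
  simp

theorem fderiv_partialDeriv_comm (hf : ContDiff ℝ (⊤ : ℕ∞) f) (x : EuclideanSpace ℝ (Fin n))
    (i j : Fin n) : fderiv ℝ (partialDeriv f i) x (EuclideanSpace.single j 1) =
      fderiv ℝ (partialDeriv f j) x (EuclideanSpace.single i 1) := by
  rw [fderiv_partialDeriv hf, fderiv_partialDeriv hf]
  exact (hf.contDiffAt.isSymmSndFDerivAt (by simp; norm_cast)) _ _

theorem divergence_pohozaev (hf : ContDiff ℝ (⊤ : ℕ∞) f)
    {x : EuclideanSpace ℝ (Fin n)} (hx : x ≠ 0) :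
    ∑ i, fderiv ℝ (pohozaev f i) x (EuclideanSpace.single i 1) =
      2 * (‖x‖ ^ 2)⁻¹ * euler f x * lap f x - (n - 4) * ((‖x‖ ^ 2)⁻¹ * gradSq f x)
        - 4 * ((‖x‖ ^ 2)⁻¹ * euler f x) ^ 2 := by
  have hl : lap f x = ∑ i, fderiv ℝ (partialDeriv f i) x (EuclideanSpace.single i 1) := by
    simp only [lap, fderiv_partialDeriv hf]
  have hq : (‖x‖ ^ 2)⁻¹ * ∑ i, x i ^ 2 = 1 := by
    rw [← EuclideanSpace.real_norm_sq_eq]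
    exact inv_mul_cancel₀ (by simpa using hx)
  have hsw : ∑ i, (∑ j, x j * fderiv ℝ (partialDeriv f j) x (EuclideanSpace.single i 1)) *
      partialDeriv f i x = ∑ i, x i * ∑ j, partialDeriv f j x *
        fderiv ℝ (partialDeriv f j) x (EuclideanSpace.single i 1) := by
    simp only [Finset.sum_mul, Finset.mul_sum]
    rw [Finset.sum_comm]
    refine Finset.sum_congr rfl fun i _ ↦ Finset.sum_congr rfl fun j _ ↦ ?_
    rw [fderiv_partialDeriv_comm hf x i j]
    ring
  have hS : ∑ i, x i * partialDeriv f i x = euler f x := rfl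
  have hG : ∑ i, partialDeriv f i x ^ 2 = gradSq f x := rfl
  simp only [fderiv_pohozaev hf hx, mul_assoc (2 : ℝ), ← Finset.mul_sum (a := (2 : ℝ))]
  set q := (‖x‖ ^ 2)⁻¹
  set S := euler f x
  set G := gradSq f x
  set A := fun i ↦ ∑ j, x j * fderiv ℝ (partialDeriv f j) x (EuclideanSpace.single i 1)
  set B := fun i ↦ ∑ j, partialDeriv f j x *
    fderiv ℝ (partialDeriv f j) x (EuclideanSpace.single i 1)
  set H := fun i ↦ fderiv ℝ (partialDeriv f i) x (EuclideanSpace.single i 1)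
  have hterm : ∀ i, -(2 * (x i * q ^ 2)) * (2 * (S * partialDeriv f i x) - x i * G) +
      q * (2 * ((partialDeriv f i x + A i) * partialDeriv f i x) + 2 * (S * H i) -
        (G + x i * (2 * B i))) =
      -4 * q ^ 2 * S * (x i * partialDeriv f i x) + 2 * q ^ 2 * G * x i ^ 2 +
      2 * q * partialDeriv f i x ^ 2 + 2 * q * (A i * partialDeriv f i x) + 2 * q * S * H i -
      q * G - 2 * q * (x i * B i) := fun i ↦ by ring
  refine (Finset.sum_congr rfl fun i _ ↦ hterm i).trans ?_
  simp only [Finset.sum_sub_distrib, Finset.sum_add_distrib, ← Finset.mul_sum, hS, hG, hl]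
  simp only [Finset.sum_const, Finset.card_univ, Fintype.card_fin, nsmul_eq_mul]
  linear_combination 2 * q * hsw + 2 * q * G * hq

theorem sq_lap_ge (hn : 8 ≤ n) (hf : ContDiff ℝ (⊤ : ℕ∞) f)
    {x : EuclideanSpace ℝ (Fin n)} (hx : x ≠ 0) :
    (n : ℝ) ^ 2 / 4 * ((‖x‖ ^ 2)⁻¹ * gradSq f x) +
      n / 2 * ∑ i, fderiv ℝ (pohozaev f i) x (EuclideanSpace.single i 1) ≤ lap f x ^ 2 := by
  rw [divergence_pohozaev hf hx]
  have hn' : (8 : ℝ) ≤ n := by exact_mod_cast hn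
  have hpos : 0 < ‖x‖ ^ 2 := by positivity
  have hcs : ((‖x‖ ^ 2)⁻¹ * euler f x) ^ 2 ≤ (‖x‖ ^ 2)⁻¹ * gradSq f x := by
    calc ((‖x‖ ^ 2)⁻¹ * euler f x) ^ 2 = ((‖x‖ ^ 2)⁻¹) ^ 2 * euler f x ^ 2 := by ring
      _ ≤ ((‖x‖ ^ 2)⁻¹) ^ 2 * (‖x‖ ^ 2 * gradSq f x) := by gcongr; exact euler_sq_le x
      _ = (‖x‖ ^ 2)⁻¹ * gradSq f x := by field_simp
  have hc : 0 ≤ (n : ℝ) / 2 * (n / 2 - 4) := by nlinarith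
  nlinarith [mul_nonneg hc (sub_nonneg.2 hcs),
    sq_nonneg (lap f x - n / 2 * ((‖x‖ ^ 2)⁻¹ * euler f x))]

end RellichHardy

open RellichHardy

theorem stmt_6 (n : ℕ) (hn : 8 ≤ n)
    (f : EuclideanSpace ℝ (Fin n) → ℝ)
    (hf : ContDiff ℝ (⊤ : ℕ∞) f) (hc : HasCompactSupport f)
    (h0 : ∀ x ∈ tsupport f, x ≠ 0) :
    ∫ x, (lap f x) ^ 2 ≥
      ((n : ℝ) ^ 2 / 4) * ∫ x, ‖gradient f x‖ ^ 2 / ‖x‖ ^ 2 := by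
  have hsupp : ∀ i, HasCompactSupport (pohozaev f i) := fun i ↦
    HasCompactSupport.intro hc fun _ hx ↦ pohozaev_eq_zero hx i
  have hP : ∀ i, Integrable fun x ↦ fderiv ℝ (pohozaev f i) x (EuclideanSpace.single i 1) :=
    fun i ↦ (((contDiff_pohozaev hf h0 i).continuous_fderiv one_ne_zero).clm_apply
      continuous_const).integrable_of_hasCompactSupport ((hsupp i).fderiv_apply (𝕜 := ℝ) _)
  have hG : Integrable fun x ↦ (‖x‖ ^ 2)⁻¹ * gradSq f x :=
    (contDiff_inv_norm_sq_mul_gradSq hf h0).continuous.integrable_of_hasCompactSupport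
      (HasCompactSupport.intro hc fun _ hx ↦ by simp [gradSq_eq_zero hx])
  have hL : Integrable fun x ↦ lap f x ^ 2 :=
    ((continuous_lap hf).pow 2).integrable_of_hasCompactSupport
      (HasCompactSupport.intro hc fun _ hx ↦ by simp [lap_eq_zero hx])
  have hdiv : ∫ x, ∑ i, fderiv ℝ (pohozaev f i) x (EuclideanSpace.single i 1) = 0 := by
    rw [integral_finsetSum _ fun i _ ↦ hP i]
    exact Finset.sum_eq_zero fun i _ ↦
      integral_fderiv_eq_zero volume (contDiff_pohozaev hf h0 i) (hsupp i) _
  have hsum := integrable_finsetSum Finset.univ fun i _ ↦ hP i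
  have : Nonempty (Fin n) := ⟨⟨0, by omega⟩⟩
  have hae : ∀ᵐ x : EuclideanSpace ℝ (Fin n), x ≠ 0 := Measure.ae_ne volume 0
  calc (n : ℝ) ^ 2 / 4 * ∫ x, ‖gradient f x‖ ^ 2 / ‖x‖ ^ 2
      = ∫ x, ((n : ℝ) ^ 2 / 4 * ((‖x‖ ^ 2)⁻¹ * gradSq f x) +
          n / 2 * ∑ i, fderiv ℝ (pohozaev f i) x (EuclideanSpace.single i 1)) := by
        rw [integral_add (hG.const_mul _) (hsum.const_mul _), integral_const_mul,
          integral_const_mul, hdiv, mul_zero, add_zero]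
        simp only [norm_gradient_sq, div_eq_inv_mul]
    _ ≤ ∫ x, lap f x ^ 2 := by
        refine integral_mono_ae ((hG.const_mul _).add (hsum.const_mul _)) hL ?_
        filter_upwards [hae] with x hx using sq_lap_ge hn hf hx
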